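/- For an integer i ≥ 1, define f_i : (0,∞) → ℝ by f_i(t) = (tanh(√t)/√t)^{2i−1}. Then for all integers i, j ≥ 1 and all t > 0, the function t ↦ t^{i+j−1} f_i(t) f_j(t) is differentiable on (0,∞) and 4(i+j−1)·t^{i+j−2}·f_{i+j−1}(t) − 4(i+j−1)·t^{i+j−1}·f_{i+j}(t) = 4·(d/dt)( t^{i+j−1} f_i(t) f_j(t) ). -/

import Mathlib

theorem hasDerivAt_real_tanh (x : ℝ) : HasDerivAt Real.tanh (1 - Real.tanh x ^ 2) x := by
  have hc : Real.cosh x ≠ 0 := (Real.cosh_pos x).ne'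
  have h := (Real.hasDerivAt_sinh x).div (Real.hasDerivAt_cosh x) hc
  refine (h.congr_deriv ?_).congr_of_eventuallyEq
    (Filter.Eventually.of_forall fun y => Real.tanh_eq_sinh_div_cosh y)
  rw [Real.tanh_eq_sinh_div_cosh]
  field_simp

theorem hasDerivAt_tanh_sqrt_pow (m : ℕ) {t : ℝ} (ht : 0 < t) :
    HasDerivAt (fun s => Real.tanh (Real.sqrt s) ^ (2 * (m + 1)))
      ((m + 1) * Real.tanh (Real.sqrt t) ^ (2 * m + 1) *
        (1 - Real.tanh (Real.sqrt t) ^ 2) / Real.sqrt t) t := by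
  have hr : Real.sqrt t ≠ 0 := (Real.sqrt_pos.mpr ht).ne'
  have h := ((hasDerivAt_real_tanh (Real.sqrt t)).comp t
    (Real.hasDerivAt_sqrt ht.ne')).pow (2 * (m + 1))
  refine h.congr_deriv ?_
  rw [show 2 * (m + 1) - 1 = 2 * m + 1 by lia]
  simp only [Function.comp_apply]
  push_cast
  field_simp

theorem pow_mul_div_sqrt_pow (x : ℝ) (n : ℕ) {s : ℝ} (hs : 0 < s) :
    s ^ n * (x / Real.sqrt s) ^ (2 * n) = x ^ (2 * n) := by
  rw [pow_mul, div_pow, Real.sq_sqrt hs.le, ← mul_pow, mul_div_cancel₀ _ hs.ne', ← pow_mul]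

/-- Verification from the proof of Lemma 3.4 of the paper: the functions
`f_i(t) = (tanh(√t)/√t)^{2i-1}` (for `i ≥ 1`) satisfy, for all `t > 0`,
`4(i+j-1) t^{i+j-2} f_{i+j-1}(t) - 4(i+j-1) t^{i+j-1} f_{i+j}(t) = 4 d/dt (t^{i+j-1} f_i f_j)`,
the function `t ↦ t^{i+j-1} f_i(t) f_j(t)` being differentiable on `(0,∞)`. -/
theorem stmt6 (f : ℕ → ℝ → ℝ)
    (hf : ∀ i, 1 ≤ i → ∀ t : ℝ, f i t =
      (Real.tanh (Real.sqrt t) / Real.sqrt t) ^ (2 * i - 1))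
    (i j : ℕ) (hi : 1 ≤ i) (hj : 1 ≤ j) (t : ℝ) (ht : 0 < t) :
    DifferentiableAt ℝ (fun s => s ^ (i + j - 1) * f i s * f j s) t ∧
      (4 * (i + j - 1) : ℕ) * t ^ (i + j - 2) * f (i + j - 1) t -
          (4 * (i + j - 1) : ℕ) * t ^ (i + j - 1) * f (i + j) t =
        4 * deriv (fun s => s ^ (i + j - 1) * f i s * f j s) t := by
  obtain ⟨a, rfl⟩ := Nat.exists_eq_add_of_le' hi
  obtain ⟨b, rfl⟩ := Nat.exists_eq_add_of_le' hj
  have hprod : (fun s => s ^ (a + 1 + (b + 1) - 1) * f (a + 1) s * f (b + 1) s) =ᶠ[nhds t]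
      fun s => Real.tanh (Real.sqrt s) ^ (2 * (a + b + 1)) := by
    filter_upwards [lt_mem_nhds ht] with s hs
    rw [hf _ hi, hf _ hj, mul_assoc, ← pow_add,
      show a + 1 + (b + 1) - 1 = a + b + 1 by lia,
      show 2 * (a + 1) - 1 + (2 * (b + 1) - 1) = 2 * (a + b + 1) by lia,
      pow_mul_div_sqrt_pow _ _ hs]
  have hderiv := (hasDerivAt_tanh_sqrt_pow (a + b) ht).congr_of_eventuallyEq hprod
  refine ⟨hderiv.differentiableAt, ?_⟩
  rw [hderiv.deriv, hf _ (by lia), hf _ (by lia),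
    show a + 1 + (b + 1) - 1 = a + b + 1 by lia,
    show a + 1 + (b + 1) - 2 = a + b by lia,
    show 2 * (a + b + 1) - 1 = 2 * (a + b) + 1 by lia,
    show 2 * (a + 1 + (b + 1)) - 1 = 2 * (a + b + 1) + 1 by lia,
    pow_succ (_ / _) (2 * (a + b)), pow_succ (_ / _) (2 * (a + b + 1)), mul_assoc, mul_assoc,
    ← mul_assoc (t ^ (a + b)), ← mul_assoc (t ^ (a + b + 1)),
    pow_mul_div_sqrt_pow _ _ ht, pow_mul_div_sqrt_pow _ _ ht]
  push_cast
  ring
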